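/- Let p ∈ (1,∞), n ≥ 2, k ∈ {1,…,n−1}, and −∞ < a_i < b_i < ∞ for i = 1,…,n−k; set D = ℝ^k × ∏_{i=1}^{n−k}(a_i,b_i) ⊆ ℝⁿ, and let I denote the canonical embedding W_0^{1,p}(D) ↪ L^p(D). Then for every m ∈ ℕ, the m-th isomorphism number satisfies i_m(I) ≥ ‖I‖; that is, for every ε > 0 and every m ∈ ℕ there exist a Banach space G with dim G ≥ m (one may take G = ℓ^p(ℝ^m)) and bounded linear operators A: L^p(D) → G, B: G → W_0^{1,p}(D) such that AIB is the identity on G and ‖A‖^{−1}‖B‖^{−1} > ‖I‖ − ε. -/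

import Mathlib

open MeasureTheory ENNReal Set Filter Topology

noncomputable section

/-- The `i`-th partial derivative of `u : ℝⁿ → ℝ`. -/
def pder {n : ℕ} (i : Fin n) (u : (Fin n → ℝ) → ℝ) (x : Fin n → ℝ) : ℝ :=
  fderiv ℝ u x (Pi.single i 1)

/-- `u` is a smooth function compactly supported in the open set `D`. -/
def IsTestFun {n : ℕ} (D : Set (Fin n → ℝ)) (u : (Fin n → ℝ) → ℝ) : Prop :=
  ContDiff ℝ (⊤ : ℕ∞) u ∧ HasCompactSupport u ∧ tsupport u ⊆ D

/-- The strip-like domain `ℝᵏ × ∏_{i ≥ k} (aᵢ, bᵢ)`, realized as a subset of `ℝⁿ`: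
the coordinates `i < k` are free, the coordinates `i ≥ k` are constrained to `(aᵢ, bᵢ)`. -/
def stripDomain (n k : ℕ) (a b : Fin n → ℝ) : Set (Fin n → ℝ) :=
  {x | ∀ i : Fin n, k ≤ (i : ℕ) → x i ∈ Set.Ioo (a i) (b i)}

/-- The ambient space `V = L^p(ℝⁿ; ℓ^p(ℝ^{n+1}))`, in which the Sobolev space `W^{1,p}_0`
is realized as the closure of the set of "jets" `(u, ∇u)` of test functions. -/
abbrev Vsp (n : ℕ) (p : ℝ≥0∞) [Fact (1 ≤ p)] :=
  Lp (PiLp p (fun _ : Fin (n + 1) => ℝ)) p (volume : Measure (Fin n → ℝ))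

/-- The "jet" `(u, ∂₁u, …, ∂ₙu)` of a function, valued in `ℓ^p(ℝ^{n+1})`. -/
def jet {n : ℕ} (p : ℝ≥0∞) (u : (Fin n → ℝ) → ℝ) (x : Fin n → ℝ) :
    PiLp p (fun _ : Fin (n + 1) => ℝ) :=
  (WithLp.equiv p (∀ _ : Fin (n + 1), ℝ)).symm (Fin.cons (u x) (fun i => pder i u x))

/-- `W^{1,p}_0(D)` realized as a closed subspace of `V`:
the closure of the subspace of jets of test functions supported in `D`.
The (subspace) norm of the jet of `u` is exactly
`(‖u‖_p^p + ‖ |∇u|_{ℓ^p} ‖_p^p)^{1/p}`, i.e., the `W^{1,p}`-norm of `u`. -/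
def W0sub {n : ℕ} (p : ℝ≥0∞) [Fact (1 ≤ p)] (D : Set (Fin n → ℝ)) : Submodule ℝ (Vsp n p) :=
  (Submodule.span ℝ {f : Vsp n p | ∃ u : (Fin n → ℝ) → ℝ, IsTestFun D u ∧
    (f : (Fin n → ℝ) → PiLp p (fun _ : Fin (n + 1) => ℝ)) =ᵐ[volume] jet p u}).topologicalClosure

instance W0sub.completeSpace {n : ℕ} (p : ℝ≥0∞) [Fact (1 ≤ p)] (D : Set (Fin n → ℝ)) :
    CompleteSpace (W0sub (n := n) p D) :=
  (Submodule.isClosed_topologicalClosure _).completeSpace_coe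

/-- Projection of a jet onto its zeroth (function) component. -/
def proj0 (n : ℕ) (p : ℝ≥0∞) [Fact (1 ≤ p)] : PiLp p (fun _ : Fin (n + 1) => ℝ) →L[ℝ] ℝ :=
  (ContinuousLinearMap.proj (0 : Fin (n + 1))).comp
    (PiLp.continuousLinearEquiv p ℝ (fun _ : Fin (n + 1) => ℝ)).toContinuousLinearMap

/-- Projection of a jet onto its gradient components, valued in `ℓ^p(ℝⁿ)`. -/
def projGrad (n : ℕ) (p : ℝ≥0∞) [Fact (1 ≤ p)] :
    PiLp p (fun _ : Fin (n + 1) => ℝ) →L[ℝ] PiLp p (fun _ : Fin n => ℝ) :=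
  ((PiLp.continuousLinearEquiv p ℝ (fun _ : Fin n => ℝ)).symm.toContinuousLinearMap).comp
    ((ContinuousLinearMap.pi fun i : Fin n => ContinuousLinearMap.proj (R := ℝ) i.succ).comp
      (PiLp.continuousLinearEquiv p ℝ (fun _ : Fin (n + 1) => ℝ)).toContinuousLinearMap)

/-- The canonical Sobolev embedding `I : W^{1,p}_0(D) → L^p(D)` (as a map into `L^p(ℝⁿ)`;
all functions in `W^{1,p}_0(D)` vanish a.e. outside `D`). -/
def SobolevEmb {n : ℕ} (p : ℝ≥0∞) [Fact (1 ≤ p)] (D : Set (Fin n → ℝ)) :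
    W0sub (n := n) p D →L[ℝ] Lp ℝ p (volume : Measure (Fin n → ℝ)) :=
  ((proj0 n p).compLpL p volume).comp (W0sub p D).subtypeL

/-- The gradient map `W^{1,p}_0(D) → L^p(D; ℓ^p(ℝⁿ))`, `u ↦ ∇u`. -/
def SobolevGrad {n : ℕ} (p : ℝ≥0∞) [Fact (1 ≤ p)] (D : Set (Fin n → ℝ)) :
    W0sub (n := n) p D →L[ℝ] Lp (PiLp p (fun _ : Fin n => ℝ)) p (volume : Measure (Fin n → ℝ)) :=
  ((projGrad n p).compLpL p volume).comp (W0sub p D).subtypeL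

/-- `π_p = 2 ∫₀¹ (1 - sᵖ)^{-1/p} ds`. -/
def piP (p : ℝ) : ℝ := 2 * ∫ s in (0 : ℝ)..1, (1 - s ^ p) ^ (-1 / p)

/-- The inverse of `t ↦ ∫₀ᵗ (1 - sᵖ)^{-1/p} ds` on `[0,1]`; this is `sin_p` on `[0, π_p/2]`. -/
def sinpHalf (p : ℝ) : ℝ → ℝ :=
  Function.invFunOn (fun t : ℝ => ∫ s in (0 : ℝ)..t, (1 - s ^ p) ^ (-1 / p)) (Set.Icc 0 1)

/-- `sin_p` on `[0, π_p]`, by reflection around `π_p/2`. -/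
def sinpBase (p t : ℝ) : ℝ :=
  if t ≤ piP p / 2 then sinpHalf p t else sinpHalf p (piP p - t)

/-- `sin_p` on `[-π_p, π_p]`, by odd reflection. -/
def sinpSym (p t : ℝ) : ℝ := if 0 ≤ t then sinpBase p t else -sinpBase p (-t)

/-- The generalized sine function `sin_p`, extended `2π_p`-periodically to all of `ℝ`. -/
def sinp (p t : ℝ) : ℝ :=
  sinpSym p (t - 2 * piP p * ⌊(t + piP p) / (2 * piP p)⌋)

/-- The generalized cosine function `cos_p = (sin_p)'`. -/
def cosp (p : ℝ) : ℝ → ℝ := deriv (sinp p)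

/-- The `m`-th entropy number of a bounded linear operator: the infimum of all `ε > 0` such
that the image of the closed unit ball can be covered by `2^{m-1}` balls of radius `ε`. -/
def entropyNumber {X Y : Type*} [NormedAddCommGroup X] [NormedSpace ℝ X]
    [NormedAddCommGroup Y] [NormedSpace ℝ Y] (m : ℕ) (T : X →L[ℝ] Y) : ℝ :=
  sInf {ε : ℝ | 0 < ε ∧ ∃ c : Fin (2 ^ (m - 1)) → Y,
    ∀ x : X, ‖x‖ ≤ 1 → ∃ j, ‖T x - c j‖ ≤ ε}

end

/-- The `m`-th isomorphism number of a bounded linear operator `T : X → Y`: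
`i_m(T) = sup ‖A‖⁻¹‖B‖⁻¹` over all Banach spaces `G` with `dim G ≥ m` and all bounded
linear `A : Y → G`, `B : G → X` with `A T B = id_G`. -/
noncomputable def isoNumber {X Y : Type} [NormedAddCommGroup X] [NormedSpace ℝ X]
    [NormedAddCommGroup Y] [NormedSpace ℝ Y] (m : ℕ) (T : X →L[ℝ] Y) : ℝ :=
  sSup {r : ℝ | ∃ (G : Type) (_i : NormedAddCommGroup G), letI := _i;
    ∃ (_j : NormedSpace ℝ G), letI := _j;
    ∃ (_c : CompleteSpace G), (m : Cardinal) ≤ Module.rank ℝ G ∧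
      ∃ (A : Y →L[ℝ] G) (B : G →L[ℝ] X),
        A.comp (T.comp B) = ContinuousLinearMap.id ℝ G ∧ r = ‖A‖⁻¹ * ‖B‖⁻¹}

section DisjointSupports

variable {α ι E F : Type*} [MeasurableSpace α] {μ : Measure α}
  [NormedAddCommGroup E] [NormedAddCommGroup F] {q : ℝ≥0∞}

theorem Lp.enorm_rpow_eq_lintegral (hq0 : q ≠ 0) (hq : q ≠ ∞) (f : Lp E q μ) :
    ‖f‖ₑ ^ q.toReal = ∫⁻ x, ‖f x‖ₑ ^ q.toReal ∂μ := by
  have hpos : q.toReal ≠ 0 := (ENNReal.toReal_pos hq0 hq).ne'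
  rw [Lp.enorm_def, eLpNorm_eq_lintegral_rpow_enorm_toReal hq0 hq, ← ENNReal.rpow_mul,
    one_div, inv_mul_cancel₀ hpos, ENNReal.rpow_one]

theorem norm_le_mul_of_enorm_rpow_le {r C : ℝ} (hr : 0 < r) (hC : 0 ≤ C) {x : E} {y : F}
    (h : ‖x‖ₑ ^ r ≤ ENNReal.ofReal C ^ r * ‖y‖ₑ ^ r) : ‖x‖ ≤ C * ‖y‖ := by
  rw [← ENNReal.mul_rpow_of_nonneg _ _ hr.le, ENNReal.rpow_le_rpow_iff hr, ← ofReal_norm,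
    ← ofReal_norm, ← ENNReal.ofReal_mul hC] at h
  exact (ENNReal.ofReal_le_ofReal_iff (by positivity)).1 h

variable [NormedSpace ℝ E] [NormedSpace ℝ F]

theorem Lp.coeFn_finsetSum_smul (s : Finset ι) (c : ι → ℝ) (f : ι → Lp E q μ) :
    ⇑(∑ j ∈ s, c j • f j) =ᵐ[μ] fun x => ∑ j ∈ s, c j • f j x := by
  classical
  induction s using Finset.induction_on with
  | empty => simp only [Finset.sum_empty]; exact Lp.coeFn_zero E q μ
  | insert i s hi ih =>
    rw [Finset.sum_insert hi]
    filter_upwards [Lp.coeFn_add (c i • f i) (∑ j ∈ s, c j • f j), Lp.coeFn_smul (c i) (f i), ih]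
      with x h1 h2 h3
    rw [h1, Pi.add_apply, h2, h3, Finset.sum_insert hi, Pi.smul_apply]

variable [Fintype ι]

/-- The `q`-th powers of the norms of a.e. disjointly supported functions add up. -/
theorem Lp.enorm_sum_smul_rpow [Fact (1 ≤ q)] (hq : q ≠ ∞) (c : ι → ℝ) (f : ι → Lp E q μ)
    {S : ι → Set α} (hS : Pairwise (Function.onFun Disjoint S))
    (hf : ∀ j, ∀ᵐ x ∂μ, x ∉ S j → f j x = 0) :
    ‖∑ j, c j • f j‖ₑ ^ q.toReal = ∑ j, ‖c j‖ₑ ^ q.toReal * ‖f j‖ₑ ^ q.toReal := by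
  have hq0 : q ≠ 0 := (zero_lt_one.trans_le Fact.out).ne'
  have hpos : 0 < q.toReal := ENNReal.toReal_pos hq0 hq
  have hmeas : ∀ j, AEMeasurable (fun x => ‖f j x‖ₑ ^ q.toReal) μ := fun j =>
    (Lp.aestronglyMeasurable (f j)).enorm.pow_const _
  simp_rw [Lp.enorm_rpow_eq_lintegral hq0 hq]
  simp_rw [← lintegral_const_mul'' _ (hmeas _)]
  rw [← lintegral_finsetSum' _ fun j _ => (hmeas j).const_mul _]
  refine lintegral_congr_ae ?_
  filter_upwards [Lp.coeFn_finsetSum_smul Finset.univ c f, ae_all_iff.2 hf] with x hx hfx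
  rw [hx]
  by_cases h : ∃ i, x ∈ S i
  · obtain ⟨i, hi⟩ := h
    have hz : ∀ j, j ≠ i → f j x = 0 := fun j hj =>
      hfx j fun hxj => Set.disjoint_left.1 (hS hj) hxj hi
    rw [Finset.sum_eq_single i (fun j _ hj => by simp [hz j hj]) (by simp),
      Finset.sum_eq_single i (fun j _ hj => by simp [hz j hj, hpos]) (by simp),
      enorm_smul, ENNReal.mul_rpow_of_nonneg _ _ hpos.le]
  · push Not at h
    have hz : ∀ j, f j x = 0 := fun j => hfx j (h j)
    simp [hz, hpos]

theorem Lp.sum_enorm_restrict_rpow_le [Fact (1 ≤ q)] (hq : q ≠ ∞) (f : Lp E q μ)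
    {S : ι → Set α} (hS : Pairwise (Function.onFun Disjoint S))
    (hSm : ∀ j, MeasurableSet (S j)) :
    ∑ j, ‖LpToLpRestrictCLM α E ℝ μ q (S j) f‖ₑ ^ q.toReal ≤ ‖f‖ₑ ^ q.toReal := by
  have hq0 : q ≠ 0 := (zero_lt_one.trans_le Fact.out).ne'
  have h : ∀ j, ‖LpToLpRestrictCLM α E ℝ μ q (S j) f‖ₑ ^ q.toReal
      = ∫⁻ x in S j, ‖f x‖ₑ ^ q.toReal ∂μ := fun j => by
    rw [Lp.enorm_rpow_eq_lintegral hq0 hq]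
    refine lintegral_congr_ae ?_
    filter_upwards [LpToLpRestrictCLM_coeFn ℝ (S j) f] with x hx
    rw [hx]
  simp_rw [h]
  rw [← tsum_fintype (L := .unconditional ι), ← lintegral_iUnion hSm hS,
    Lp.enorm_rpow_eq_lintegral hq0 hq]
  exact setLIntegral_le_lintegral _ _

theorem LpToLpRestrictCLM_eq_zero [Fact (1 ≤ q)] (f : Lp E q μ) {S T : Set α}
    (hT : MeasurableSet T) (hST : Disjoint S T)
    (hf : ∀ᵐ x ∂μ, x ∉ S → f x = 0) : LpToLpRestrictCLM α E ℝ μ q T f = 0 := by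
  rw [Lp.eq_zero_iff_ae_eq_zero]
  filter_upwards [LpToLpRestrictCLM_coeFn ℝ T f, ae_restrict_of_ae hf, ae_restrict_mem hT]
    with x hx h hxT
  rw [hx, h fun hxS => Set.disjoint_left.1 hST hxS hxT, Pi.zero_apply]

theorem LpToLpRestrictCLM_norm_eq [Fact (1 ≤ q)] (f : Lp E q μ) {S : Set α}
    (hS : MeasurableSet S) (hf : ∀ᵐ x ∂μ, x ∉ S → f x = 0) :
    ‖LpToLpRestrictCLM α E ℝ μ q S f‖ = ‖f‖ := by
  rw [Lp.norm_def, Lp.norm_def, eLpNorm_congr_ae (LpToLpRestrictCLM_coeFn ℝ S f),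
    ← eLpNorm_indicator_eq_eLpNorm_restrict hS]
  congr 1
  refine eLpNorm_congr_ae ?_
  filter_upwards [hf] with x hx
  by_cases h : x ∈ S
  · simp [h]
  · simp [h, hx h]

theorem PiLp.enorm_rpow_eq_sum [Fact (1 ≤ q)] (hq : q ≠ ∞) (c : PiLp q fun _ : ι => ℝ) :
    ‖c‖ₑ ^ q.toReal = ∑ j, ‖c j‖ₑ ^ q.toReal := by
  have hpos : 0 < q.toReal := ENNReal.toReal_pos (zero_lt_one.trans_le Fact.out).ne' hq
  have h : ‖c‖ ^ q.toReal = ∑ j, ‖c j‖ ^ q.toReal := by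
    rw [PiLp.norm_eq_sum hpos, ← Real.rpow_mul (by positivity), one_div,
      inv_mul_cancel₀ hpos.ne', Real.rpow_one]
  simp_rw [← ofReal_norm, ENNReal.ofReal_rpow_of_nonneg (norm_nonneg _) hpos.le]
  rw [h, ENNReal.ofReal_sum_of_nonneg fun _ _ => by positivity]

/-- An operator `T` on a subspace of `L^q` factors the identity of `ℓ^q(ι)` through disjointly
supported functions `f j` of norm `β` with disjointly supported images of norm `γ`. -/
theorem exists_factorization_of_disjoint_supports [Fact (1 ≤ q)] (hq : q ≠ ∞) [Nonempty ι]
    (W : Submodule ℝ (Lp E q μ)) (T : W →L[ℝ] Lp F q μ) (f : ι → W) {S : ι → Set α}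
    (hS : Pairwise (Function.onFun Disjoint S)) (hSm : ∀ j, MeasurableSet (S j))
    (hf : ∀ j, ∀ᵐ x ∂μ, x ∉ S j → (f j : Lp E q μ) x = 0)
    (hTf : ∀ j, ∀ᵐ x ∂μ, x ∉ S j → T (f j) x = 0)
    {β γ : ℝ} (hγ : 0 < γ) (hβf : ∀ j, ‖f j‖ = β) (hγf : ∀ j, ‖T (f j)‖ = γ) :
    ∃ (A : Lp F q μ →L[ℝ] PiLp q fun _ : ι => ℝ) (B : (PiLp q fun _ : ι => ℝ) →L[ℝ] W),
      A.comp (T.comp B) = ContinuousLinearMap.id ℝ (PiLp q fun _ : ι => ℝ) ∧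
        γ / β ≤ ‖A‖⁻¹ * ‖B‖⁻¹ := by
  classical
  have hpos : 0 < q.toReal := ENNReal.toReal_pos (zero_lt_one.trans_le Fact.out).ne' hq
  have hβ : 0 ≤ β := hβf (Classical.arbitrary ι) ▸ norm_nonneg _
  have hres : ∀ j, ‖LpToLpRestrictCLM α F ℝ μ q (S j) (T (f j))‖ = γ := fun j =>
    (LpToLpRestrictCLM_norm_eq _ (hSm j) (hTf j)).trans (hγf j)
  choose φ hφ1 hφ2 using fun j => exists_dual_vector ℝ
    (LpToLpRestrictCLM α F ℝ μ q (S j) (T (f j))) (by rw [hres]; exact hγ.ne')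
  let B₀ : (PiLp q fun _ : ι => ℝ) →ₗ[ℝ] W :=
    { toFun := fun c => ∑ j, c j • f j
      map_add' := fun c d => by simp [add_smul, Finset.sum_add_distrib]
      map_smul' := fun r c => by simp [mul_smul, Finset.smul_sum] }
  have hB₀ : ∀ c, ‖B₀ c‖ ≤ β * ‖c‖ := fun c => by
    have hcoe : ((B₀ c : W) : Lp E q μ) = ∑ j, c j • (f j : Lp E q μ) := by
      simp [B₀]
    rw [Submodule.coe_norm, hcoe]
    refine norm_le_mul_of_enorm_rpow_le hpos hβ ?_
    rw [Lp.enorm_sum_smul_rpow hq _ _ hS hf, PiLp.enorm_rpow_eq_sum hq, Finset.mul_sum]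
    refine Finset.sum_le_sum fun j _ => ?_
    rw [mul_comm, ← ofReal_norm (f j : Lp E q μ), ← Submodule.coe_norm, hβf]
  let A₀ : Lp F q μ →ₗ[ℝ] PiLp q fun _ : ι => ℝ :=
    { toFun := fun h => WithLp.toLp q fun j => γ⁻¹ * φ j (LpToLpRestrictCLM α F ℝ μ q (S j) h)
      map_add' := fun g h => by ext j; simp [mul_add]
      map_smul' := fun r h => by ext j; simp; ring }
  have hA₀ : ∀ h, ‖A₀ h‖ ≤ γ⁻¹ * ‖h‖ := fun h => by
    refine norm_le_mul_of_enorm_rpow_le hpos (by positivity) ?_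
    rw [PiLp.enorm_rpow_eq_sum hq]
    refine le_trans ?_ (mul_le_mul_right (Lp.sum_enorm_restrict_rpow_le hq h hS hSm) _)
    rw [Finset.mul_sum]
    refine Finset.sum_le_sum fun j _ => ?_
    rw [← ENNReal.mul_rpow_of_nonneg _ _ hpos.le]
    refine ENNReal.rpow_le_rpow ?_ hpos.le
    change ‖γ⁻¹ * φ j (LpToLpRestrictCLM α F ℝ μ q (S j) h)‖ₑ ≤ _
    rw [enorm_mul, Real.enorm_of_nonneg (by positivity)]
    refine mul_le_mul_right ?_ _
    rw [← ofReal_norm, ← ofReal_norm]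
    refine ENNReal.ofReal_le_ofReal ?_
    simpa [hφ1 j] using (φ j).le_opNorm (LpToLpRestrictCLM α F ℝ μ q (S j) h)
  have hdual : ∀ i j, γ⁻¹ * φ i (LpToLpRestrictCLM α F ℝ μ q (S i) (T (f j)))
      = if i = j then 1 else 0 := fun i j => by
    split_ifs with h
    · subst h
      rw [hφ2, hres]
      simp [hγ.ne']
    · rw [LpToLpRestrictCLM_eq_zero (T (f j)) (hSm i) (hS (Ne.symm h)) (hTf j)]
      simp
  have hid : (A₀.mkContinuous _ hA₀).comp (T.comp (B₀.mkContinuous _ hB₀))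
      = ContinuousLinearMap.id ℝ (PiLp q fun _ : ι => ℝ) := by
    ext c i
    change γ⁻¹ * φ i (LpToLpRestrictCLM α F ℝ μ q (S i) (T (∑ j, c j • f j))) = c i
    simp only [map_sum, map_smul, Finset.mul_sum, smul_eq_mul]
    simp_rw [mul_left_comm γ⁻¹, hdual]
    simp
  refine ⟨_, _, hid, ?_⟩
  have hA : ‖A₀.mkContinuous _ hA₀‖ ≤ γ⁻¹ := LinearMap.mkContinuous_norm_le _ (by positivity) _
  have hB : ‖B₀.mkContinuous _ hB₀‖ ≤ β := LinearMap.mkContinuous_norm_le _ hβ _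
  obtain ⟨c, hc⟩ : ∃ c : PiLp q fun _ : ι => ℝ, c ≠ 0 :=
    ⟨PiLp.single q (Classical.arbitrary ι) (1 : ℝ), by simp⟩
  have hpair : ∀ (A : Lp F q μ →L[ℝ] PiLp q fun _ : ι => ℝ)
      (B : (PiLp q fun _ : ι => ℝ) →L[ℝ] W),
      A.comp (T.comp B) = ContinuousLinearMap.id ℝ _ → 0 < ‖A‖ ∧ 0 < ‖B‖ := fun A B h => by
    have hABc : A (T (B c)) = c := DFunLike.congr_fun h c
    constructor
    · exact norm_pos_iff.2 fun h0 : A = 0 => hc (by rw [← hABc, h0]; rfl)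
    · exact (norm_pos_iff (a := B)).2 fun h0 => hc (by rw [← hABc, h0]; simp)
  obtain ⟨hA0, hB0⟩ := hpair _ _ hid
  rw [div_eq_mul_inv]
  refine mul_le_mul ?_ (inv_anti₀ hB0 hB) (by positivity) (by positivity)
  simpa using inv_anti₀ hA0 hA

end DisjointSupports

/-- Every admissible quotient for `isoNumber` is at most the operator norm. -/
theorem inv_norm_mul_inv_norm_le {X Y G : Type*} [NormedAddCommGroup X] [NormedSpace ℝ X]
    [NormedAddCommGroup Y] [NormedSpace ℝ Y] [NormedAddCommGroup G] [NormedSpace ℝ G]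
    (T : X →L[ℝ] Y) (A : Y →L[ℝ] G) (B : G →L[ℝ] X)
    (h : A.comp (T.comp B) = ContinuousLinearMap.id ℝ G) : ‖A‖⁻¹ * ‖B‖⁻¹ ≤ ‖T‖ := by
  rcases subsingleton_or_nontrivial G with hG | hG
  · have : B = 0 := by ext x; simp [Subsingleton.elim x 0]
    simp [this]
  · have h1 : 1 ≤ ‖A‖ * (‖T‖ * ‖B‖) := by
      rw [← ContinuousLinearMap.norm_id (𝕜 := ℝ) (E := G), ← h]
      exact (A.opNorm_comp_le _).trans (by gcongr; exact T.opNorm_comp_le _)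
    have hA : 0 < ‖A‖ := (norm_nonneg A).lt_of_ne fun h0 => by
      rw [← h0] at h1; norm_num at h1
    have hB : 0 < ‖B‖ := (norm_nonneg B).lt_of_ne fun h0 => by
      rw [← h0] at h1; norm_num at h1
    rw [← mul_inv, inv_le_iff_one_le_mul₀ (by positivity)]
    linarith

theorem le_isoNumber {X Y G : Type} [NormedAddCommGroup X] [NormedSpace ℝ X]
    [NormedAddCommGroup Y] [NormedSpace ℝ Y] [NormedAddCommGroup G] [NormedSpace ℝ G]
    [CompleteSpace G] {m : ℕ} (hm : (m : Cardinal) ≤ Module.rank ℝ G)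
    (T : X →L[ℝ] Y) (A : Y →L[ℝ] G) (B : G →L[ℝ] X)
    (h : A.comp (T.comp B) = ContinuousLinearMap.id ℝ G) : ‖A‖⁻¹ * ‖B‖⁻¹ ≤ isoNumber m T := by
  refine le_csSup ⟨‖T‖, ?_⟩ ⟨G, _, _, inferInstance, hm, A, B, h, rfl⟩
  rintro r ⟨G', _, _, _, _, A', B', h', rfl⟩
  exact inv_norm_mul_inv_norm_le T A' B' h'

section Jets

variable {n : ℕ} {D : Set (Fin n → ℝ)} {u v : (Fin n → ℝ) → ℝ}

theorem jet_apply_succ (q : ℝ≥0∞) (u : (Fin n → ℝ) → ℝ) (x : Fin n → ℝ) (i : Fin n) :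
    jet q u x i.succ = pder i u x := rfl

theorem IsTestFun.zero : IsTestFun D (0 : (Fin n → ℝ) → ℝ) :=
  ⟨contDiff_const, HasCompactSupport.zero, by simp [tsupport]⟩

theorem IsTestFun.add (hu : IsTestFun D u) (hv : IsTestFun D v) : IsTestFun D (u + v) :=
  ⟨hu.1.add hv.1, hu.2.1.add hv.2.1, (tsupport_add u v).trans (union_subset hu.2.2 hv.2.2)⟩

theorem IsTestFun.const_smul (c : ℝ) (hu : IsTestFun D u) : IsTestFun D (c • u) :=
  ⟨hu.1.const_smul c, hu.2.1.smul_left (f := fun _ => c),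
    (tsupport_smul_subset_right (fun _ => c) u).trans hu.2.2⟩

theorem IsTestFun.comp_sub (hu : IsTestFun D u) {w : Fin n → ℝ} (hw : ∀ x, x - w ∈ D → x ∈ D) :
    IsTestFun D fun x => u (x - w) := by
  refine ⟨hu.1.comp (contDiff_id.sub contDiff_const),
    hu.2.1.comp_homeomorph (Homeomorph.subRight w), fun x hx => hw x (hu.2.2 ?_)⟩
  exact tsupport_comp_subset_preimage u (f := fun x => x - w) (by fun_prop) hx

theorem IsTestFun.differentiable (hu : IsTestFun D u) : Differentiable ℝ u :=
  hu.1.differentiable (by simp)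

theorem jet_add (q : ℝ≥0∞) (hu : Differentiable ℝ u) (hv : Differentiable ℝ v) :
    jet q (u + v) = jet q u + jet q v := by
  ext x i
  refine Fin.cases rfl (fun i => ?_) i
  simp [jet_apply_succ, pder, fderiv_add (hu x) (hv x)]

theorem jet_const_smul (q : ℝ≥0∞) (c : ℝ) (hu : Differentiable ℝ u) :
    jet q (c • u) = c • jet q u := by
  ext x i
  refine Fin.cases rfl (fun i => ?_) i
  simp [jet_apply_succ, pder, fderiv_const_smul (hu x)]

theorem jet_comp_sub (q : ℝ≥0∞) (u : (Fin n → ℝ) → ℝ) (w : Fin n → ℝ) :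
    jet q (fun x => u (x - w)) = jet q u ∘ fun x => x - w := by
  ext x i
  refine Fin.cases rfl (fun i => ?_) i
  simp [jet_apply_succ, pder, fderiv_comp_sub]

theorem jet_eq_zero_of_notMem_tsupport (q : ℝ≥0∞) {x : Fin n → ℝ} (hx : x ∉ tsupport u) :
    jet q u x = 0 := by
  ext i
  refine Fin.cases (image_eq_zero_of_notMem_tsupport (f := u) hx) (fun i => ?_) i
  simp [jet_apply_succ, pder, fderiv_of_notMem_tsupport ℝ hx]

theorem jet_zero (q : ℝ≥0∞) : jet q (0 : (Fin n → ℝ) → ℝ) = 0 := by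
  ext1 x
  exact jet_eq_zero_of_notMem_tsupport q (by simp [tsupport])

theorem IsTestFun.continuous_jet (q : ℝ≥0∞) [Fact (1 ≤ q)] (hu : IsTestFun D u) :
    Continuous (jet q u) := by
  refine (PiLp.continuous_toLp q _).comp (continuous_pi fun i => ?_)
  refine Fin.cases hu.1.continuous (fun i => ?_) i
  exact (hu.1.continuous_fderiv (by simp)).clm_apply continuous_const

theorem IsTestFun.memLp_jet (q : ℝ≥0∞) [Fact (1 ≤ q)] (hu : IsTestFun D u) :
    MemLp (jet q u) q (volume : Measure (Fin n → ℝ)) :=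
  (hu.continuous_jet q).memLp_of_hasCompactSupport <|
    HasCompactSupport.intro hu.2.1 fun _ hx => jet_eq_zero_of_notMem_tsupport q hx

variable {q : ℝ≥0∞} [Fact (1 ≤ q)]

/-- The element of `W₀^{1,q}(D)` given by a test function. -/
noncomputable def IsTestFun.toW0 (q : ℝ≥0∞) [Fact (1 ≤ q)] (hu : IsTestFun D u) : W0sub q D :=
  ⟨(hu.memLp_jet q).toLp, Submodule.le_topologicalClosure _ <|
    Submodule.subset_span ⟨u, hu, MemLp.coeFn_toLp _⟩⟩

theorem IsTestFun.coeFn_toW0 (hu : IsTestFun D u) :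
    ⇑(hu.toW0 q : Vsp n q) =ᵐ[volume] jet q u :=
  MemLp.coeFn_toLp (hu.memLp_jet q)

theorem IsTestFun.coeFn_sobolevEmb_toW0 (hu : IsTestFun D u) :
    ⇑(SobolevEmb q D (hu.toW0 q)) =ᵐ[volume] u := by
  filter_upwards [(proj0 n q).coeFn_compLpL (hu.toW0 q : Vsp n q), hu.coeFn_toW0 (q := q)]
    with x h1 h2
  change ((proj0 n q).compLpL q volume (hu.toW0 q : Vsp n q)) x = u x
  rw [h1, h2]
  rfl

theorem IsTestFun.norm_toW0_comp_sub (hu : IsTestFun D u) {w : Fin n → ℝ}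
    (hw : IsTestFun D fun x => u (x - w)) : ‖hw.toW0 q‖ = ‖hu.toW0 q‖ := by
  rw [Submodule.coe_norm, Submodule.coe_norm, Lp.norm_def, Lp.norm_def,
    eLpNorm_congr_ae hu.coeFn_toW0, eLpNorm_congr_ae hw.coeFn_toW0, jet_comp_sub,
    eLpNorm_comp_measurePreserving (hu.memLp_jet q).1 (measurePreserving_sub_right volume w)]

theorem IsTestFun.norm_sobolevEmb_toW0_comp_sub (hu : IsTestFun D u) {w : Fin n → ℝ}
    (hw : IsTestFun D fun x => u (x - w)) :
    ‖SobolevEmb q D (hw.toW0 q)‖ = ‖SobolevEmb q D (hu.toW0 q)‖ := by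
  rw [Lp.norm_def, Lp.norm_def, eLpNorm_congr_ae hu.coeFn_sobolevEmb_toW0,
    eLpNorm_congr_ae hw.coeFn_sobolevEmb_toW0]
  exact congrArg _ (eLpNorm_comp_measurePreserving hu.1.continuous.aestronglyMeasurable
    (measurePreserving_sub_right volume w))

/-- A bound for the Sobolev embedding may be checked on test functions. -/
theorem sobolevEmb_norm_le_of_isTestFun {r : ℝ} (hr : 0 ≤ r)
    (h : ∀ u (hu : IsTestFun D u), ‖SobolevEmb q D (hu.toW0 q)‖ ≤ r * ‖hu.toW0 q‖) :
    ‖SobolevEmb q D‖ ≤ r := by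
  refine ContinuousLinearMap.opNorm_le_bound _ hr fun x => ?_
  have hclosed : IsClosed {f : Vsp n q | ‖(proj0 n q).compLpL q volume f‖ ≤ r * ‖f‖} :=
    isClosed_le (by fun_prop) (by fun_prop)
  refine closure_minimal (fun f hf => ?_) hclosed x.2
  have hjet : ∃ u, IsTestFun D u ∧ ⇑f =ᵐ[volume] jet q u := by
    induction hf using Submodule.span_induction with
    | mem f hf => exact hf
    | zero => exact ⟨0, IsTestFun.zero, by rw [jet_zero]; exact Lp.coeFn_zero _ _ _⟩
    | add f g _ _ hf hg =>
      obtain ⟨u, hu, hfu⟩ := hf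
      obtain ⟨v, hv, hgv⟩ := hg
      refine ⟨u + v, hu.add hv, ?_⟩
      rw [jet_add q hu.differentiable hv.differentiable]
      exact (Lp.coeFn_add f g).trans (hfu.add hgv)
    | smul c f _ hf =>
      obtain ⟨u, hu, hfu⟩ := hf
      refine ⟨c • u, hu.const_smul c, ?_⟩
      rw [jet_const_smul q c hu.differentiable]
      exact (Lp.coeFn_smul c f).trans (hfu.const_smul c)
  obtain ⟨u, hu, hfu⟩ := hjet
  have hf' : f = (hu.toW0 q : Vsp n q) := Lp.ext (hfu.trans hu.coeFn_toW0.symm)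
  rw [hf']
  exact h u hu

theorem sobolevEmb_norm_pos (hD : (interior D).Nonempty) : 0 < ‖SobolevEmb q D‖ := by
  obtain ⟨x, hx⟩ := hD
  obtain ⟨u, hus, huc, hu, -, hux⟩ :=
    exists_contDiff_tsupport_subset (n := ⊤) (mem_interior_iff_mem_nhds.1 hx)
  have htest : IsTestFun D u := ⟨hu, huc, hus⟩
  refine (norm_pos_iff (a := SobolevEmb q D)).2 fun h0 => ?_
  have h1 : u =ᵐ[volume] fun _ => (0 : ℝ) := by
    refine htest.coeFn_sobolevEmb_toW0 (q := q).symm.trans ?_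
    rw [h0]
    exact Lp.coeFn_zero _ _ _
  have h2 := (Continuous.ae_eq_iff_eq volume hu.continuous continuous_const).1 h1
  simp [h2] at hux

end Jets

theorem stripDomain_interior_nonempty {n k : ℕ} {a b : Fin n → ℝ}
    (hab : ∀ i : Fin n, k ≤ (i : ℕ) → a i < b i) : (interior (stripDomain n k a b)).Nonempty := by
  have hopen : IsOpen (stripDomain n k a b) := by
    have : stripDomain n k a b
        = ⋂ i : Fin n, ⋂ _ : k ≤ (i : ℕ), (fun x : Fin n → ℝ => x i) ⁻¹' Ioo (a i) (b i) := by
      ext x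
      simp [stripDomain]
    rw [this]
    exact isOpen_iInter_of_finite fun i => isOpen_iInter_of_finite fun _ =>
      isOpen_Ioo.preimage (continuous_apply i)
  rw [hopen.interior_eq]
  exact ⟨fun i => (a i + b i) / 2, fun i hi => by
    have := hab i hi
    constructor <;> dsimp only <;> linarith⟩

theorem mem_stripDomain_of_sub_single {n k : ℕ} {a b : Fin n → ℝ} {i : Fin n} (hi : (i : ℕ) < k)
    (t : ℝ) (x : Fin n → ℝ) (hx : x - Pi.single i t ∈ stripDomain n k a b) :
    x ∈ stripDomain n k a b := fun j hj => by
  have hji : j ≠ i := by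
    rintro rfl
    omega
  simpa [hji] using hx j hj

/-- Sufficiently far translates of a compact set along a coordinate axis are disjoint. -/
theorem exists_pairwise_disjoint_translates {n : ℕ} {K : Set (Fin n → ℝ)} (hK : IsCompact K)
    (i : Fin n) : ∃ t : ℝ, Pairwise (Function.onFun Disjoint
      fun j : ℕ => (fun x : Fin n → ℝ => x - Pi.single i (t * (j : ℝ))) ⁻¹' K) := by
  obtain ⟨R, hR⟩ := hK.isBounded.exists_norm_le
  refine ⟨2 * |R| + 1, fun j l hjl => Set.disjoint_left.2 fun x hj hl => ?_⟩
  have h1 := (norm_le_pi_norm _ i).trans (hR _ hj)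
  have h2 := (norm_le_pi_norm _ i).trans (hR _ hl)
  simp only [Pi.sub_apply, Pi.single_eq_same, Real.norm_eq_abs] at h1 h2
  have h3 : (1 : ℝ) ≤ |(j : ℝ) - l| := by
    have : (1 : ℤ) ≤ |(j : ℤ) - l| := Int.one_le_abs (by omega)
    exact_mod_cast this
  have h4 : |(2 * |R| + 1) * ((j : ℝ) - l)| ≤ 2 * R := by
    have : (2 * |R| + 1) * ((j : ℝ) - l)
        = (x i - (2 * |R| + 1) * l) - (x i - (2 * |R| + 1) * j) := by ring
    rw [this]
    exact (abs_sub _ _).trans (by linarith)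
  have h5 : 0 ≤ |R| := abs_nonneg R
  rw [abs_mul, abs_of_pos (by linarith : 0 < 2 * |R| + 1)] at h4
  nlinarith [le_abs_self R]

theorem exists_factorization_sobolevEmb_stripDomain {n k : ℕ} (hk1 : 1 ≤ k) (hk : k < n)
    {q : ℝ≥0∞} [Fact (1 ≤ q)] (hq : q ≠ ∞) {a b : Fin n → ℝ} {m : ℕ} (hm : 1 ≤ m)
    {r : ℝ} (hr : 0 ≤ r) (hrI : r < ‖SobolevEmb q (stripDomain n k a b)‖) :
    ∃ (A : Lp ℝ q (volume : Measure (Fin n → ℝ)) →L[ℝ] PiLp q fun _ : Fin m => ℝ)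
      (B : (PiLp q fun _ : Fin m => ℝ) →L[ℝ] W0sub q (stripDomain n k a b)),
      A.comp ((SobolevEmb q (stripDomain n k a b)).comp B)
          = ContinuousLinearMap.id ℝ (PiLp q fun _ : Fin m => ℝ) ∧
        r < ‖A‖⁻¹ * ‖B‖⁻¹ := by
  have hex : ∃ u, ∃ hu : IsTestFun (stripDomain n k a b) u,
      r * ‖hu.toW0 q‖ < ‖SobolevEmb q (stripDomain n k a b) (hu.toW0 q)‖ := by
    by_contra! h
    exact hrI.not_ge (sobolevEmb_norm_le_of_isTestFun hr h)
  obtain ⟨u, hu, hur⟩ := hex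
  let i : Fin n := ⟨0, by omega⟩
  obtain ⟨t, ht⟩ := exists_pairwise_disjoint_translates hu.2.1 i
  have htest : ∀ j : Fin m,
      IsTestFun (stripDomain n k a b) fun x => u (x - Pi.single i (t * ((j : ℕ) : ℝ))) := fun j =>
    hu.comp_sub (mem_stripDomain_of_sub_single (i := i) hk1 _)
  have : Nonempty (Fin m) := ⟨⟨0, hm⟩⟩
  have hγ : 0 < ‖SobolevEmb q (stripDomain n k a b) (hu.toW0 q)‖ :=
    lt_of_le_of_lt (by positivity) hur
  have hβ : 0 < ‖hu.toW0 q‖ := norm_pos_iff.2 fun h => by simp [h] at hγ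
  obtain ⟨A, B, hAB, hle⟩ := exists_factorization_of_disjoint_supports hq
    (W0sub q (stripDomain n k a b)) (SobolevEmb q (stripDomain n k a b))
    (fun j => (htest j).toW0 q)
    (S := fun j : Fin m => (fun x : Fin n → ℝ => x - Pi.single i (t * ((j : ℕ) : ℝ))) ⁻¹' tsupport u)
    (fun j l hjl => ht (Fin.val_injective.ne hjl))
    (fun j => ((isClosed_tsupport u).preimage (by fun_prop)).measurableSet)
    (fun j => (htest j).coeFn_toW0.mono fun x hx hxS => by
      rw [hx, jet_comp_sub]
      exact jet_eq_zero_of_notMem_tsupport q hxS)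
    (fun j => (htest j).coeFn_sobolevEmb_toW0.mono fun x hx hxS => by
      rw [hx]
      exact image_eq_zero_of_notMem_tsupport hxS)
    hγ (fun j => hu.norm_toW0_comp_sub _) (fun j => hu.norm_sobolevEmb_toW0_comp_sub _)
  exact ⟨A, B, hAB, ((lt_div_iff₀ hβ).2 hur).trans_le hle⟩

/-- For the canonical embedding `I : W₀^{1,p}(D) ↪ L^p(D)` on the
strip-like domain `D = ℝᵏ × ∏_{i=1}^{n-k} (aᵢ,bᵢ)`, the `m`-th isomorphism number satisfies
`i_m(I) ≥ ‖I‖`; explicitly, for every `ε > 0` one may take `G = ℓ^p(ℝ^m)` and find bounded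
linear `A : L^p(D) → G`, `B : G → W₀^{1,p}(D)` with `A I B = id_G` and
`‖A‖⁻¹‖B‖⁻¹ > ‖I‖ - ε`. -/
theorem isoNumber_sobolevEmbedding_stripDomain
    (n k : ℕ) (hn : 2 ≤ n) (hk1 : 1 ≤ k) (hk : k < n) (p : ℝ) (hp : 1 < p)
    (a b : Fin n → ℝ) (hab : ∀ i : Fin n, k ≤ (i : ℕ) → a i < b i)
    (m : ℕ) (hm : 1 ≤ m) :
    letI : Fact (1 ≤ ENNReal.ofReal p) := ⟨ENNReal.one_le_ofReal.mpr hp.le⟩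
    isoNumber m (SobolevEmb (ENNReal.ofReal p) (stripDomain n k a b)) ≥
        ‖SobolevEmb (ENNReal.ofReal p) (stripDomain n k a b)‖ ∧
      ∀ ε : ℝ, 0 < ε →
        ∃ (A : Lp ℝ (ENNReal.ofReal p) (volume : Measure (Fin n → ℝ)) →L[ℝ]
              PiLp (ENNReal.ofReal p) (fun _ : Fin m => ℝ))
          (B : PiLp (ENNReal.ofReal p) (fun _ : Fin m => ℝ) →L[ℝ]
              W0sub (ENNReal.ofReal p) (stripDomain n k a b)),
          A.comp ((SobolevEmb (ENNReal.ofReal p) (stripDomain n k a b)).comp B) =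
              ContinuousLinearMap.id ℝ (PiLp (ENNReal.ofReal p) (fun _ : Fin m => ℝ)) ∧
            ‖A‖⁻¹ * ‖B‖⁻¹ >
              ‖SobolevEmb (ENNReal.ofReal p) (stripDomain n k a b)‖ - ε := by
  have : Fact (1 ≤ ENNReal.ofReal p) := ⟨ENNReal.one_le_ofReal.mpr hp.le⟩
  have hI : 0 < ‖SobolevEmb (ENNReal.ofReal p) (stripDomain n k a b)‖ :=
    sobolevEmb_norm_pos (stripDomain_interior_nonempty hab)
  refine ⟨le_of_forall_lt fun r hr => ?_, fun ε hε => ?_⟩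
  · obtain ⟨A, B, hAB, hlt⟩ := exists_factorization_sobolevEmb_stripDomain hk1 hk
      ENNReal.ofReal_ne_top hm (le_max_right r 0) (max_lt hr hI)
    refine ((le_max_left r 0).trans_lt hlt).trans_le (le_isoNumber ?_ _ A B hAB)
    rw [← Module.finrank_eq_rank,
      Module.finrank_eq_card_basis (PiLp.basisFun (ENNReal.ofReal p) ℝ (Fin m)),
      Fintype.card_fin]
  · obtain ⟨A, B, hAB, hlt⟩ := exists_factorization_sobolevEmb_stripDomain hk1 hk
      ENNReal.ofReal_ne_top hm (le_max_right _ 0) (max_lt (sub_lt_self _ hε) hI)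
    exact ⟨A, B, hAB, (le_max_left _ 0).trans_lt hlt⟩
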